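/- Let C be a program core (a finite set of rules, each with a head and a nonempty body) over atoms A such that no two rules of C are conflicting, and such that every atom occurring in a head of C is internal (i.e., occurs in some head). Let I be any valid input for C, i.e., a consistent set of facts whose atoms are external (occur in some body of C but in no head of C). Then no answer set of C ∪ I contains a pair of strongly complementary classical literals; equivalently, the inconsistent set Lit_A of all classical literals is not an answer set of C ∪ I. -/

import Mathlib

/-! ## Classical and extended literals -/

/-- A classical literal over atoms `A`: an atom `a` (positive) or a strongly
negated atom `¬a` (negative). -/
inductive CLit (A : Type) : Type
  | pos : A → CLit A
  | neg : A → CLit A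
deriving DecidableEq

namespace CLit

/-- The strong complement of a classical literal. -/
def compl {A : Type} : CLit A → CLit A
  | pos a => neg a
  | neg a => pos a

/-- The underlying atom of a classical literal. -/
def atom {A : Type} : CLit A → A
  | pos a => a
  | neg a => a

end CLit

/-- Two classical literals are strongly complementary. -/
def StronglyComp {A : Type} (L L' : CLit A) : Prop := L' = L.compl

/-- A set of classical literals is consistent iff it contains no strongly
complementary pair. -/
def Consistent {A : Type} (S : Set (CLit A)) : Prop := ∀ L ∈ S, L.compl ∉ S

/-- An extended literal: a classical literal `L` or a default-negated
classical literal `not L`. -/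
inductive ELit (A : Type) : Type
  | lit : CLit A → ELit A
  | not : CLit A → ELit A
deriving DecidableEq

namespace ELit

/-- The underlying atom of an extended literal. -/
def atom {A : Type} : ELit A → A
  | lit L => L.atom
  | not L => L.atom

end ELit

/-- Two extended literals are atom-related iff they have the same underlying atom. -/
def AtomRelated {A : Type} (e e' : ELit A) : Prop := e.atom = e'.atom

/-- Strongly complementary extended literals: `L` and its strong complement. -/
def EStrComp {A : Type} (e e' : ELit A) : Prop :=
  ∃ L : CLit A, e = ELit.lit L ∧ e' = ELit.lit L.compl

/-- Default complementary extended literals: `L` and `not L`. -/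
def EDefComp {A : Type} (e e' : ELit A) : Prop :=
  ∃ L : CLit A, (e = ELit.lit L ∧ e' = ELit.not L) ∨ (e = ELit.not L ∧ e' = ELit.lit L)

/-- Complementary extended literals: strongly or default complementary. -/
def EComp {A : Type} (e e' : ELit A) : Prop := EStrComp e e' ∨ EDefComp e e'

/-- Dual extended literals: `L` and `not (strong complement of L)`. -/
def EDual {A : Type} (e e' : ELit A) : Prop :=
  ∃ L : CLit A, (e = ELit.lit L ∧ e' = ELit.not L.compl) ∨ (e = ELit.not L.compl ∧ e' = ELit.lit L)

/-- Reconcilable extended literals: `not L` and `not (strong complement of L)`. -/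
def EReconc {A : Type} (e e' : ELit A) : Prop :=
  ∃ L : CLit A, e = ELit.not L ∧ e' = ELit.not L.compl

/-- Satisfaction of an extended literal by a set of classical literals:
`S ⊨ L` iff `L ∈ S`, and `S ⊨ not L` iff `L ∉ S`. -/
def SatE {A : Type} (S : Set (CLit A)) : ELit A → Prop
  | ELit.lit L => L ∈ S
  | ELit.not L => L ∉ S

/-- A set `S` of classical literals satisfies a set `X` of extended literals
iff it satisfies every element of `X`. -/
def SatAll {A : Type} (S : Set (CLit A)) (X : Set (ELit A)) : Prop := ∀ e ∈ X, SatE S e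

/-! ## Rules and programs -/

/-- A rule: a head (a classical literal) and a finite body of extended literals. -/
structure Rule (A : Type) where
  head : CLit A
  body : Finset (ELit A)

/-- The classical literals occurring positively in the body, `B⁺(r)`. -/
def Rule.bodyPos {A : Type} (r : Rule A) : Set (CLit A) := {L | ELit.lit L ∈ r.body}

/-- The classical literals occurring default-negated in the body, `B⁻(r)`. -/
def Rule.bodyNeg {A : Type} (r : Rule A) : Set (CLit A) := {L | ELit.not L ∈ r.body}

/-- A rule is applicable iff some consistent set of classical literals
satisfies its body. -/
def Applicable {A : Type} (r : Rule A) : Prop :=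
  ∃ S : Set (CLit A), Consistent S ∧ SatAll S ↑r.body

/-- Two rules `r ≠ r'` are conflicting iff their heads are strongly complementary
and some consistent set of classical literals satisfies both bodies. -/
def Conflicting {A : Type} (r r' : Rule A) : Prop :=
  r ≠ r' ∧ StronglyComp r.head r'.head ∧
    ∃ S : Set (CLit A), Consistent S ∧ SatAll S ↑r.body ∧ SatAll S ↑r'.body

/-! ## Answer set semantics -/

/-- `S` is a model of the positive parts: for each rule, the head is in `S`
whenever the positive body is contained in `S`. -/
def PModel {A : Type} (P : Set (Rule A)) (S : Set (CLit A)) : Prop :=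
  ∀ r ∈ P, r.bodyPos ⊆ S → r.head ∈ S

/-- The least model of a program without default negation. -/
def leastModel {A : Type} (P : Set (Rule A)) : Set (CLit A) := ⋂₀ {S | PModel P S}

open Classical in
/-- The answer set of a program without default negation: the least model if it
is consistent, and the set `Lit_A` of all classical literals otherwise. -/
noncomputable def posAnswerSet {A : Type} (P : Set (Rule A)) : Set (CLit A) :=
  if Consistent (leastModel P) then leastModel P else Set.univ

/-- Whether an extended literal is a (positive occurrence of a) classical literal. -/
def ELit.isPos {A : Type} : ELit A → Bool
  | ELit.lit _ => true
  | ELit.not _ => false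

/-- The reduct `P^S`: keep the rules with `B⁻(r) ∩ S = ∅`, as `H(r) ← B⁺(r)`. -/
def reduct {A : Type} (P : Set (Rule A)) (S : Set (CLit A)) : Set (Rule A) :=
  {r' | ∃ r ∈ P, r.bodyNeg ∩ S = ∅ ∧ r' = ⟨r.head, r.body.filter (fun e => e.isPos)⟩}

/-- `S` is an answer set of `P` iff `S` is the answer set of the reduct `P^S`. -/
def AnswerSet {A : Type} (P : Set (Rule A)) (S : Set (CLit A)) : Prop :=
  S = posAnswerSet (reduct P S)

/-- The fact corresponding to a classical literal: a rule with empty body. -/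
def fact {A : Type} (L : CLit A) : Rule A := ⟨L, ∅⟩

/-! ## Blankets and the negation operator -/

/-- The adversarial rules of `r` in the program `P`. -/
def Adv {A : Type} (P : Set (Rule A)) (r : Rule A) : Set (Rule A) :=
  {r' ∈ P | Conflicting r r'}

/-- The negation operator on extended literals:
`neg a = {not a, ¬a}`, `neg ¬a = {not ¬a, a}`, `neg (not a) = {a}`, `neg (not ¬a) = {¬a}`. -/
def negE {A : Type} : ELit A → Set (ELit A)
  | ELit.lit L => {ELit.not L, ELit.lit L.compl}
  | ELit.not L => {ELit.lit L}

/-- `neg(e, X) = ⋂ {neg k : k ∈ X, k atom-related to e}`. -/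
def negDep {A : Type} (e : ELit A) (X : Set (ELit A)) : Set (ELit A) :=
  ⋂ k ∈ {k ∈ X | AtomRelated k e}, negE k

/-- `Neg(X)`: all sets `T` of extended literals containing exactly one element of
each nonempty set `neg(e, X)` for `e ∈ X`, and nothing else. -/
def NegSets {A : Type} (X : Set (ELit A)) : Set (Set (ELit A)) :=
  {T | (∀ e ∈ X, (negDep e X).Nonempty → ∃! t, t ∈ T ∧ t ∈ negDep e X) ∧
       (∀ t ∈ T, ∃ e ∈ X, t ∈ negDep e X)}

/-- All blanket conditions except `⊆`-minimality: nonempty, no complementary pair,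
no reconcilable pair, atoms disjoint from the atoms of `B(r)`, and meeting the body
of every adversarial rule of `r`. -/
def PreBlanket {A : Type} (P : Set (Rule A)) (r : Rule A) (β : Set (ELit A)) : Prop :=
  β.Nonempty ∧
  (∀ e ∈ β, ∀ e' ∈ β, ¬ EComp e e') ∧
  (∀ e ∈ β, ∀ e' ∈ β, ¬ EReconc e e') ∧
  (∀ e ∈ β, ∀ e' ∈ r.body, e.atom ≠ ELit.atom e') ∧
  (∀ rj ∈ Adv P r, ∃ e ∈ β, e ∈ rj.body)

/-- A blanket for `Adv(r)` (with ambient program `P`): a `⊆`-minimal set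
satisfying the blanket conditions. -/
def Blanket {A : Type} (P : Set (Rule A)) (r : Rule A) (β : Set (ELit A)) : Prop :=
  PreBlanket P r β ∧ ∀ β' ⊆ β, PreBlanket P r β' → β' = β

open Classical

/-- The immediate consequences of a set `X` of classical literals under the rules of `P`,
whose default-negated literals are ignored. -/
def immediateConsequences {A : Type} (P : Set (Rule A)) (X : Set (CLit A)) : Set (CLit A) :=
  {L | ∃ r ∈ P, r.bodyPos ⊆ X ∧ r.head = L}

theorem immediateConsequences_mono {A : Type} (P : Set (Rule A)) {X Y : Set (CLit A)}
    (h : X ⊆ Y) : immediateConsequences P X ⊆ immediateConsequences P Y := by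
  rintro L ⟨r, hr, hX, rfl⟩
  exact ⟨r, hr, hX.trans h, rfl⟩

theorem Consistent.mono {A : Type} {S T : Set (CLit A)} (hT : Consistent T) (h : S ⊆ T) :
    Consistent S :=
  fun L hL hL' => hT L (h hL) (h hL')

/-- The union of a chain of consistent sets is consistent. -/
theorem Consistent.sUnion_of_isChain {A : Type} {c : Set (Set (CLit A))}
    (hc : IsChain (· ⊆ ·) c) (h : ∀ X ∈ c, Consistent X) : Consistent (⋃₀ c) := by
  rintro L ⟨X, hX, hLX⟩ ⟨Y, hY, hLY⟩
  rcases hc.total hX hY with hXY | hYX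
  · exact h Y hY L (hXY hLX) hLY
  · exact h X hX L hLX (hYX hLY)

/-- If taking immediate consequences preserves consistency, the least model is consistent. -/
theorem consistent_leastModel {A : Type} (P : Set (Rule A))
    (h : ∀ X, Consistent X → Consistent (immediateConsequences P X)) :
    Consistent (leastModel P) := by
  obtain ⟨X, hX⟩ := zorn_subset {X | Consistent X ∧ X ⊆ immediateConsequences P X} (by
    intro c hcs hc
    refine ⟨⋃₀ c, ⟨Consistent.sUnion_of_isChain hc fun X hX => (hcs hX).1, ?_⟩,
      fun X hX => Set.subset_sUnion_of_mem hX⟩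
    exact Set.sUnion_subset fun X hX => (hcs hX).2.trans
      (immediateConsequences_mono P (Set.subset_sUnion_of_mem hX)))
  have hle : immediateConsequences P X ⊆ X :=
    hX.le_of_ge ⟨h X hX.prop.1, immediateConsequences_mono P hX.prop.2⟩ hX.prop.2
  have hmodel : PModel P X := fun r hr hb => hle ⟨r, hr, hb, rfl⟩
  exact hX.prop.1.mono (Set.sInter_subset_of_mem hmodel)

theorem mem_immediateConsequences_reduct_univ {A : Type} {P : Set (Rule A)}
    {X : Set (CLit A)} {L : CLit A} :
    L ∈ immediateConsequences (reduct P Set.univ) X ↔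
      ∃ r ∈ P, r.bodyNeg = ∅ ∧ r.bodyPos ⊆ X ∧ r.head = L := by
  simp only [immediateConsequences, reduct, Set.inter_univ, Set.mem_ofPred_eq]
  constructor
  · rintro ⟨_, ⟨r, hr, hn, rfl⟩, hb, rfl⟩
    exact ⟨r, hr, hn, fun K hK => hb (Finset.mem_filter.2 ⟨hK, rfl⟩), rfl⟩
  · rintro ⟨r, hr, hn, hb, rfl⟩
    exact ⟨_, ⟨r, hr, hn, rfl⟩, fun K hK => hb (Finset.mem_filter.1 hK).1, rfl⟩

theorem satAll_body {A : Type} {r : Rule A} {X : Set (CLit A)} (hn : r.bodyNeg = ∅)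
    (hp : r.bodyPos ⊆ X) : SatAll X ↑r.body := by
  rintro (L | L) he
  · exact hp he
  · exact absurd (show L ∈ r.bodyNeg from he) (by simp [hn])

theorem CLit.atom_compl {A : Type} (L : CLit A) : L.compl.atom = L.atom := by
  cases L <;> rfl

theorem CLit.compl_ne {A : Type} (L : CLit A) : L.compl ≠ L := by
  cases L <;> simp [CLit.compl]

/-- If a program core `C` (finite, rules with nonempty bodies) has no
conflicting rules and every head atom is internal, then for any valid input `I`
(a consistent set of facts over external atoms), no answer set of `C ∪ I` contains a
pair of strongly complementary classical literals (equivalently, the inconsistent set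
of all classical literals is not an answer set of `C ∪ I`). -/
theorem stmt_3 {A : Type} (C : Finset (Rule A))
    (hbody : ∀ r ∈ C, r.body ≠ ∅)
    (hnoconf : ∀ r ∈ C, ∀ r' ∈ C, ¬ Conflicting r r')
    (hinternal : ∀ r ∈ C, ∃ r' ∈ C, r.head.atom = r'.head.atom)
    (I : Set (CLit A)) (hIcons : Consistent I)
    (hext : ∀ L ∈ I,
      (∃ r ∈ C, ∃ e ∈ r.body, ELit.atom e = L.atom) ∧
      (∀ r ∈ C, r.head.atom ≠ L.atom)) :
    ∀ S : Set (CLit A), AnswerSet (↑C ∪ fact '' I) S → Consistent S := by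
  intro S hS
  unfold AnswerSet posAnswerSet at hS
  split_ifs at hS with hcons
  · rwa [← hS] at hcons
  · subst hS
    refine absurd (consistent_leastModel _ fun X hX L hL hL' => ?_) hcons
    obtain ⟨r, hr, hn, hp, rfl⟩ := mem_immediateConsequences_reduct_univ.1 hL
    obtain ⟨r', hr', hn', hp', hcompl⟩ := mem_immediateConsequences_reduct_univ.1 hL'
    have hatom : r'.head.atom = r.head.atom := by rw [hcompl, CLit.atom_compl]
    rcases hr with hr | ⟨K, hK, rfl⟩ <;> rcases hr' with hr' | ⟨K', hK', rfl⟩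
    · refine hnoconf r hr r' hr' ⟨?_, hcompl, X, hX, satAll_body hn hp, satAll_body hn' hp'⟩
      rintro rfl
      exact CLit.compl_ne _ hcompl.symm
    · exact (hext K' hK').2 r hr hatom.symm
    · exact (hext K hK).2 r' hr' hatom
    · have hKK' : K' = K.compl := hcompl
      exact hIcons K hK (hKK' ▸ hK')
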